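/- Let α be a real number with 3/4 < α ≤ 1, σ ∈ {−1, +1}, N ∈ ℕ ∪ {∞} and s ≥ 2 − 2α. There is a constant C_s > 0, depending only on s and α, such that for all sequences u, v : ℤ → ℂ with finite H^s norms: (i) ‖X_N(u)‖_{H^s} ≤ C_s ‖u‖_{H^s}² ‖u‖_{L²}; (ii) ‖X_N(u) − X_N(v)‖_{H^s} ≤ C_s ‖u − v‖_{H^s} ( ‖u‖_{H^s}² + ‖v‖_{H^s}² ). -/

import Mathlib

open scoped BigOperators ENNReal ComplexConjugate Classical
open Filter Set MeasureTheory ComplexConjugate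

noncomputable section

/-- `ℝ≥0∞`-valued `H^s` norm of a sequence of Fourier coefficients. -/
def hsE (s : ℝ) (u : ℤ → ℂ) : ℝ≥0∞ :=
  (∑' n : ℤ, ENNReal.ofReal (1 + |(n : ℝ)| ^ (2 * s)) * (‖u n‖₊ : ℝ≥0∞) ^ 2) ^ ((1:ℝ)/2)

/-- `ℝ≥0∞`-valued `FL^{0,1}` norm. -/
def flE (u : ℤ → ℂ) : ℝ≥0∞ := ∑' n : ℤ, (‖u n‖₊ : ℝ≥0∞)

/-- real-valued `H^s` norm. -/
def hsR (s : ℝ) (u : ℤ → ℂ) : ℝ :=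
  Real.sqrt (∑' n : ℤ, (1 + |(n : ℝ)| ^ (2 * s)) * ‖u n‖ ^ 2)

/-- real-valued `FL^{0,1}` norm. -/
def flR (u : ℤ → ℂ) : ℝ := ∑' n : ℤ, ‖u n‖

/-- The condition `|j| ≤ N` for `N ∈ ℕ ∪ {∞}`. -/
def inBall (N : ℕ∞) (j : ℤ) : Prop := (j.natAbs : ℕ∞) ≤ N

/-- The resonance function `Φ_α`. -/
def res (α : ℝ) (j₁ j₂ j₃ : ℤ) : ℝ :=
  |(j₁ : ℝ)| ^ (2 * α) + |(j₂ : ℝ)| ^ (2 * α) - |(j₃ : ℝ)| ^ (2 * α)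
    - |((j₁ + j₂ - j₃ : ℤ) : ℝ)| ^ (2 * α)

/-- The (truncated) Birkhoff vector field `X_N`. -/
def XB (α σ : ℝ) (N : ℕ∞) (u : ℤ → ℂ) : ℤ → ℂ := fun n =>
  if inBall N n then
    ∑' p : ℤ × ℤ,
      (if inBall N p.1 ∧ inBall N p.2 ∧ inBall N (p.1 + p.2 - n) ∧
          res α p.1 p.2 (p.1 + p.2 - n) ≠ 0 then
        ((-σ / res α p.1 p.2 (p.1 + p.2 - n) : ℝ) : ℂ) *
          (u p.1 * u p.2 * conj (u (p.1 + p.2 - n)))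
      else 0)
  else 0

/-- Truncation `Π_N`. -/
def trunc (N : ℕ) (u : ℤ → ℂ) : ℤ → ℂ := fun n => if n.natAbs ≤ N then u n else 0

/-- Derivative of a curve at `t`, in the `H^s` norm. -/
def HasHsDerivAt (s : ℝ) (u : ℝ → ℤ → ℂ) (d : ℤ → ℂ) (t : ℝ) : Prop :=
  Tendsto (fun h : ℝ => hsE s (fun n => (u (t + h) n - u t n) / (h : ℂ) - d n))
    (nhdsWithin 0 {(0 : ℝ)}ᶜ) (nhds 0)

/-- Derivative of a curve at `t` within a set `A` of times, in the `H^s` norm. -/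
def HasHsDerivWithinAt (s : ℝ) (u : ℝ → ℤ → ℂ) (d : ℤ → ℂ) (A : Set ℝ) (t : ℝ) : Prop :=
  Tendsto (fun h : ℝ => hsE s (fun n => (u (t + h) n - u t n) / (h : ℂ) - d n))
    (nhdsWithin 0 {h : ℝ | t + h ∈ A ∧ h ≠ 0}) (nhds 0)

/-- Continuity of a curve in the `H^s` norm. -/
def ContHs (s : ℝ) (D : ℝ → ℤ → ℂ) : Prop :=
  ∀ t : ℝ, Tendsto (fun t' => hsE s (fun n => D t' n - D t n)) (nhds t) (nhds 0)

/-- Continuity of a curve in the `H^s` norm, on a set of times. -/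
def ContHsOn (s : ℝ) (A : Set ℝ) (D : ℝ → ℤ → ℂ) : Prop :=
  ∀ t ∈ A, Tendsto (fun t' => hsE s (fun n => D t' n - D t n)) (nhdsWithin t A) (nhds 0)

/-- `u` is a global-in-time solution of `d/dt u = X_N(u)`, as a curve in `H^s`. -/
def IsSol (α σ : ℝ) (N : ℕ∞) (s : ℝ) (u : ℝ → ℤ → ℂ) : Prop :=
  ∀ t : ℝ, hsE s (u t) ≠ ⊤ ∧ HasHsDerivAt s u (XB α σ N (u t)) t

/-- `u` solves `d/dt u = X_N(u)` on the set of times `A`, as a curve in `H^s`. -/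
def IsSolOn (α σ : ℝ) (N : ℕ∞) (s : ℝ) (A : Set ℝ) (u : ℝ → ℤ → ℂ) : Prop :=
  ∀ t ∈ A, hsE s (u t) ≠ ⊤ ∧ HasHsDerivWithinAt s u (XB α σ N (u t)) A t

/-- `u` is a global-in-time continuously differentiable solution, as a curve in `H^s`. -/
def IsC1Sol (α σ : ℝ) (N : ℕ∞) (s : ℝ) (u : ℝ → ℤ → ℂ) : Prop :=
  IsSol α σ N s u ∧ ContHs s (fun t => XB α σ N (u t))

/-- `u` is a continuously differentiable solution on the set of times `A`. -/
def IsC1SolOn (α σ : ℝ) (N : ℕ∞) (s : ℝ) (A : Set ℝ) (u : ℝ → ℤ → ℂ) : Prop :=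
  IsSolOn α σ N s A u ∧ ContHsOn s A (fun t => XB α σ N (u t))

/-- integer modes in `[-N, N]`. -/
def Ifin (N : ℕ) : Finset ℤ := Finset.Icc (-(N:ℤ)) (N:ℤ)

/-- The quartic form `‖Π_N u‖⁴_{L⁴}`. -/
def qL4 (N : ℕ) (u : ℤ → ℂ) : ℝ :=
  (∑ j₁ ∈ Ifin N, ∑ j₂ ∈ Ifin N, ∑ j₃ ∈ Ifin N, ∑ j₄ ∈ Ifin N,
    if j₁ + j₂ = j₃ + j₄ then u j₁ * u j₂ * conj (u j₃) * conj (u j₄) else 0).re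

/-- `G_N(u)`, the derivative at `t = 0` of the energy along the truncated Birkhoff flow. -/
def GN (α σ : ℝ) (N : ℕ) (u : ℤ → ℂ) : ℝ :=
  -(σ/2) * qL4 N u + σ * (∑ j ∈ Ifin N, ‖u j‖^2)^2
  + 2 * σ * (∑ n₁ ∈ Ifin N, ∑ n₂ ∈ Ifin N, ∑ m₁ ∈ Ifin N, ∑ m₂ ∈ Ifin N,
      if n₁ + n₂ = m₁ + m₂ then
        XB α σ (N : ℕ∞) (trunc N u) n₁ * u n₂ * conj (u m₁) * conj (u m₂)
      else 0).re


theorem rpow_diff_ge {p J x y : ℝ} (hp0 : 0 < p) (hp1 : p ≤ 1) (hy : 0 ≤ y) (hyx : y ≤ x)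
    (hx : x ≤ J) : p * J ^ (p - 1) * (x - y) ≤ x ^ p - y ^ p := by
  rcases hy.trans hyx |>.eq_or_lt with h0 | h0
  · have : y = 0 := by linarith
    subst h0; subst this; simp
  have hB := rpow_one_add_le_one_add_mul_self (s := y / x - 1) (p := p)
    (by have : 0 ≤ y / x := by positivity
        linarith) hp0.le hp1
  rw [add_sub_cancel, Real.div_rpow hy h0.le, div_le_iff₀ (by positivity)] at hB
  have hJ : J ^ (p - 1) ≤ x ^ (p - 1) := Real.rpow_le_rpow_of_nonpos h0 hx (by linarith)
  have hxp : x ^ p = x ^ (p - 1) * x := by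
    rw [← Real.rpow_add_one h0.ne']; ring_nf
  have h1 : p * J ^ (p - 1) * (x - y) ≤ p * x ^ (p - 1) * (x - y) := by
    have : 0 ≤ x - y := by linarith
    gcongr
  have h2 : (1 + p * (y / x - 1)) * x ^ p = x ^ p - p * x ^ (p - 1) * (x - y) := by
    rw [hxp]; field_simp; ring
  linarith

theorem monotoneOn_abs_rpow_mul_sub {γ J : ℝ} (hγ1 : 1 < γ) (hγ2 : γ ≤ 2) :
    MonotoneOn (fun x : ℝ => γ * |x| ^ (γ - 2) * x - γ * (γ - 1) * J ^ (γ - 2) * x)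
      (Icc (-J) J) := by
  have key : ∀ x : ℝ, 0 ≤ x → x ^ (γ - 2) * x = x ^ (γ - 1) := by
    intro x hx
    rcases hx.eq_or_lt with h | h
    · subst h; rw [mul_zero, Real.zero_rpow (by linarith)]
    · rw [← Real.rpow_add_one h.ne']; ring_nf
  have base : ∀ x y : ℝ, 0 ≤ y → y ≤ x → x ≤ J →
      (γ - 1) * J ^ (γ - 2) * (x - y) ≤ x ^ (γ - 2) * x - y ^ (γ - 2) * y := by
    intro x y hy hyx hx
    rw [key x (hy.trans hyx), key y hy]
    have := rpow_diff_ge (p := γ - 1) (by linarith) (by linarith) hy hyx hx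
    rwa [show γ - 1 - 1 = γ - 2 by ring] at this
  intro y hy x hx hyx
  obtain ⟨hy1, hy2⟩ := hy
  obtain ⟨hx1, hx2⟩ := hx
  suffices h : (γ - 1) * J ^ (γ - 2) * (x - y) ≤ |x| ^ (γ - 2) * x - |y| ^ (γ - 2) * y by
    have := mul_le_mul_of_nonneg_left h (by linarith : 0 ≤ γ)
    simp only
    linarith
  rcases le_total 0 y with h | h
  · rw [abs_of_nonneg h, abs_of_nonneg (h.trans hyx)]
    exact base x y h hyx hx2
  · rcases le_total 0 x with h' | h'
    · rw [abs_of_nonpos h, abs_of_nonneg h']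
      have h1 := base x 0 le_rfl h' hx2
      have h2 := base (-y) 0 le_rfl (by linarith) (by linarith)
      linarith
    · rw [abs_of_nonpos h, abs_of_nonpos h']
      have h1 := base (-y) (-x) (by linarith) (by linarith) (by linarith)
      linarith

theorem convexOn_abs_rpow_sub_sq {γ J : ℝ} (hγ1 : 1 < γ) (hγ2 : γ ≤ 2) :
    ConvexOn ℝ (Icc (-J) J)
      (fun x : ℝ => |x| ^ γ - γ * (γ - 1) * J ^ (γ - 2) / 2 * x ^ 2) := by
  have hd : ∀ x : ℝ, HasDerivAt
      (fun x : ℝ => |x| ^ γ - γ * (γ - 1) * J ^ (γ - 2) / 2 * x ^ 2)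
      (γ * |x| ^ (γ - 2) * x - γ * (γ - 1) * J ^ (γ - 2) * x) x := by
    intro x
    have h := (hasDerivAt_abs_rpow x hγ1).sub
      ((hasDerivAt_pow 2 x).const_mul (γ * (γ - 1) * J ^ (γ - 2) / 2))
    refine h.congr_deriv ?_
    push_cast
    ring
  refine MonotoneOn.convexOn_of_deriv (convex_Icc _ _)
    (fun x _ => (hd x).continuousAt.continuousWithinAt)
    (fun x _ => (hd x).differentiableAt.differentiableWithinAt) ?_
  have : deriv (fun x : ℝ => |x| ^ γ - γ * (γ - 1) * J ^ (γ - 2) / 2 * x ^ 2) =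
      fun x : ℝ => γ * |x| ^ (γ - 2) * x - γ * (γ - 1) * J ^ (γ - 2) * x :=
    funext fun x => (hd x).deriv
  rw [this]
  exact (monotoneOn_abs_rpow_mul_sub hγ1 hγ2).mono interior_subset

theorem ConvexOn.add_le_add_of_mul_pos {S : Set ℝ} {g : ℝ → ℝ} (hg : ConvexOn ℝ S g)
    {x k l : ℝ} (hkl : 0 < k * l) (h0 : x ∈ S) (h1 : x + k + l ∈ S) :
    g (x + k) + g (x + l) ≤ g x + g (x + k + l) := by
  have hne : k + l ≠ 0 := by
    intro h
    have : l = -k := by linarith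
    subst this
    nlinarith [sq_nonneg k]
  have hk : 0 ≤ k / (k + l) := by
    have : k / (k + l) = (k ^ 2 + k * l) / (k + l) ^ 2 := by field_simp
    rw [this]; positivity
  have hl : 0 ≤ l / (k + l) := by
    have : l / (k + l) = (l ^ 2 + k * l) / (k + l) ^ 2 := by field_simp; ring
    rw [this]; positivity
  have hs : l / (k + l) + k / (k + l) = 1 := by field_simp; ring
  have a1 := hg.2 h0 h1 hl hk hs
  have a2 := hg.2 h0 h1 hk hl (by rw [add_comm]; exact hs)
  simp only [smul_eq_mul] at a1 a2
  have e1 : l / (k + l) * x + k / (k + l) * (x + k + l) = x + k := by field_simp; ring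
  have e2 : k / (k + l) * x + l / (k + l) * (x + k + l) = x + l := by field_simp; ring
  rw [e1] at a1
  rw [e2] at a2
  have : l / (k + l) = 1 - k / (k + l) := by linarith
  rw [this] at a1 a2
  linarith

theorem abs_rpow_second_diff_ge {γ J x k l : ℝ} (hγ1 : 1 < γ) (hγ2 : γ ≤ 2)
    (hkl : 0 < k * l) (h0 : |x| ≤ J) (h1 : |x + k + l| ≤ J) :
    γ * (γ - 1) * J ^ (γ - 2) * (k * l) ≤
      |x| ^ γ + |x + k + l| ^ γ - |x + k| ^ γ - |x + l| ^ γ := by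
  have := (convexOn_abs_rpow_sub_sq (J := J) hγ1 hγ2).add_le_add_of_mul_pos hkl
    (abs_le.1 h0) (abs_le.1 h1)
  linarith

theorem abs_second_diff_abs_rpow_ge {γ J x k l : ℝ} (hγ1 : 1 < γ) (hγ2 : γ ≤ 2)
    (h0 : |x| ≤ J) (h1 : |x + k| ≤ J) (h2 : |x + l| ≤ J) (h3 : |x + k + l| ≤ J) :
    γ * (γ - 1) * J ^ (γ - 2) * (|k| * |l|) ≤
      |(|x + k| ^ γ + |x + l| ^ γ - |x + k + l| ^ γ - |x| ^ γ)| := by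
  rw [← abs_mul]
  rcases lt_trichotomy (k * l) 0 with h | h | h
  · have := abs_rpow_second_diff_ge (x := x + k) (k := -k) (l := l) hγ1 hγ2 (by linarith) h1
      (by simpa using h2)
    rw [abs_of_neg h]
    refine le_trans ?_ (le_abs_self _)
    rw [show x + k + -k = x by ring] at this
    linarith
  · rw [h]; simp
  · have := abs_rpow_second_diff_ge hγ1 hγ2 h h0 h3
    rw [abs_of_pos h]
    refine le_trans ?_ (neg_le_abs _)
    linarith

theorem one_add_abs_rpow_mul_ratio_le {s δ a b c n : ℝ} (hδ0 : 0 ≤ δ) (hδ1 : δ ≤ 1 / 2)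
    (hs : δ ≤ s) (hn : a + b = c + n) (hk : 1 ≤ |a - n|) (hl : 1 ≤ |b - n|) :
    (1 + |n| ^ (2 * s)) * ((|a| + |b| + |c|) / (|a - n| * |b - n|)) ^ (2 * δ) ≤
      8 * ((10 : ℝ) ^ (2 * s)) ^ 2 *
        ((1 + |a| ^ (2 * s)) * (1 + |b| ^ (2 * s)) + (1 + |a| ^ (2 * s)) * (1 + |c| ^ (2 * s))
          + (1 + |b| ^ (2 * s)) * (1 + |c| ^ (2 * s))) := by
  have hk' : |a - n| = |c - b| := by congr 1; linarith
  have hl' : |b - n| = |c - a| := by congr 1; linarith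
  set J := |a| + |b| + |c| with hJ
  set P := |a - n| * |b - n| with hP
  set D := (10 : ℝ) ^ (2 * s) with hD
  have hs0 : 0 ≤ s := hδ0.trans hs
  have hJ1 : 1 ≤ J := by
    have := abs_sub c b
    have := abs_nonneg a
    linarith
  have hP1 : 1 ≤ P := one_le_mul_of_one_le_of_one_le hk hl
  have hD1 : 1 ≤ D := Real.one_le_rpow (by norm_num) (by linarith)
  have hJs : 1 ≤ J ^ (2 * s) := Real.one_le_rpow hJ1 (by linarith)
  have hnJ : |n| ≤ J := by
    have : n = a + b - c := by linarith
    rw [this]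
    exact (abs_sub _ _).trans (by linarith [abs_add_le a b])
  have hW : 1 + |n| ^ (2 * s) ≤ 2 * J ^ (2 * s) := by
    have : |n| ^ (2 * s) ≤ J ^ (2 * s) :=
      Real.rpow_le_rpow (abs_nonneg _) hnJ (by linarith)
    linarith
  have hbig : ∀ t : ℝ, J / 10 ≤ |t| → J ^ (2 * s) ≤ D * (1 + |t| ^ (2 * s)) := by
    intro t ht
    have h1 : J ^ (2 * s) ≤ (10 * |t|) ^ (2 * s) :=
      Real.rpow_le_rpow (by linarith) (by linarith) (by linarith)
    rw [Real.mul_rpow (by norm_num) (abs_nonneg _)] at h1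
    linarith
  have hw : ∀ t : ℝ, 1 ≤ 1 + |t| ^ (2 * s) := fun t => by
    have : 0 ≤ |t| ^ (2 * s) := Real.rpow_nonneg (abs_nonneg _) _
    linarith
  have hratio0 : 0 ≤ (J / P) ^ (2 * δ) := by positivity
  have hratio : (J / P) ^ (2 * δ) ≤ J ^ (2 * s) := by
    refine (Real.rpow_le_rpow (by positivity) (div_le_self (by linarith) hP1)
      (by linarith)).trans ?_
    exact Real.rpow_le_rpow_of_exponent_le hJ1 (by linarith)
  have two_big : ∀ t r : ℝ, J / 10 ≤ |t| → J / 10 ≤ |r| →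
      (1 + |n| ^ (2 * s)) * (J / P) ^ (2 * δ) ≤
        8 * D ^ 2 * ((1 + |t| ^ (2 * s)) * (1 + |r| ^ (2 * s))) := by
    intro t r ht hr
    calc (1 + |n| ^ (2 * s)) * (J / P) ^ (2 * δ)
        ≤ (2 * (D * (1 + |t| ^ (2 * s)))) * (D * (1 + |r| ^ (2 * s))) := by
          have := hbig t ht
          refine mul_le_mul (by linarith) (hratio.trans (hbig r hr)) hratio0 ?_
          have := hw t
          positivity
      _ = 2 * (D ^ 2 * ((1 + |t| ^ (2 * s)) * (1 + |r| ^ (2 * s)))) := by ring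
      _ ≤ 8 * (D ^ 2 * ((1 + |t| ^ (2 * s)) * (1 + |r| ^ (2 * s)))) := by
          have : 0 ≤ D ^ 2 * ((1 + |t| ^ (2 * s)) * (1 + |r| ^ (2 * s))) := by positivity
          linarith
      _ = _ := by ring
  have one_big : ∀ t r : ℝ, J / 10 ≤ |t| → J / 2 ≤ P →
      (1 + |n| ^ (2 * s)) * (J / P) ^ (2 * δ) ≤
        8 * D ^ 2 * ((1 + |t| ^ (2 * s)) * (1 + |r| ^ (2 * s))) := by
    intro t r ht hJP
    have h2 : (J / P) ^ (2 * δ) ≤ 2 := by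
      have h3 : J / P ≤ 2 := by rw [div_le_iff₀ (by linarith)]; linarith
      calc (J / P) ^ (2 * δ) ≤ 2 ^ (2 * δ) :=
            Real.rpow_le_rpow (by positivity) h3 (by linarith)
        _ ≤ 2 ^ (1 : ℝ) := Real.rpow_le_rpow_of_exponent_le (by norm_num) (by linarith)
        _ = 2 := by norm_num
    have ht' := hw t
    have hr' := hw r
    calc (1 + |n| ^ (2 * s)) * (J / P) ^ (2 * δ)
        ≤ (2 * (D * (1 + |t| ^ (2 * s)))) * 2 := by
          have := hbig t ht
          exact mul_le_mul (by linarith) h2 hratio0 (by positivity)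
      _ ≤ 8 * (D * (1 + |t| ^ (2 * s))) := by
          have : 0 ≤ D * (1 + |t| ^ (2 * s)) := by positivity
          linarith
      _ = 8 * (D * (1 * (1 + |t| ^ (2 * s)))) * 1 := by ring
      _ ≤ 8 * (D * (D * (1 + |t| ^ (2 * s)))) * (1 + |r| ^ (2 * s)) := by gcongr
      _ = _ := by ring
  have hab : 0 ≤ (1 + |a| ^ (2 * s)) * (1 + |b| ^ (2 * s)) := by positivity
  have hac : 0 ≤ (1 + |a| ^ (2 * s)) * (1 + |c| ^ (2 * s)) := by positivity
  have hbc : 0 ≤ (1 + |b| ^ (2 * s)) * (1 + |c| ^ (2 * s)) := by positivity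
  have hDD : 0 ≤ 8 * D ^ 2 := by positivity
  have fin_ab := fun h : (1 + |n| ^ (2 * s)) * (J / P) ^ (2 * δ) ≤
      8 * D ^ 2 * ((1 + |a| ^ (2 * s)) * (1 + |b| ^ (2 * s))) =>
    h.trans (mul_le_mul_of_nonneg_left (by linarith :
      _ ≤ (1 + |a| ^ (2 * s)) * (1 + |b| ^ (2 * s)) + (1 + |a| ^ (2 * s)) * (1 + |c| ^ (2 * s))
          + (1 + |b| ^ (2 * s)) * (1 + |c| ^ (2 * s))) hDD)
  have fin_ac := fun h : (1 + |n| ^ (2 * s)) * (J / P) ^ (2 * δ) ≤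
      8 * D ^ 2 * ((1 + |a| ^ (2 * s)) * (1 + |c| ^ (2 * s))) =>
    h.trans (mul_le_mul_of_nonneg_left (by linarith :
      _ ≤ (1 + |a| ^ (2 * s)) * (1 + |b| ^ (2 * s)) + (1 + |a| ^ (2 * s)) * (1 + |c| ^ (2 * s))
          + (1 + |b| ^ (2 * s)) * (1 + |c| ^ (2 * s))) hDD)
  have fin_bc := fun h : (1 + |n| ^ (2 * s)) * (J / P) ^ (2 * δ) ≤
      8 * D ^ 2 * ((1 + |b| ^ (2 * s)) * (1 + |c| ^ (2 * s))) =>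
    h.trans (mul_le_mul_of_nonneg_left (by linarith :
      _ ≤ (1 + |a| ^ (2 * s)) * (1 + |b| ^ (2 * s)) + (1 + |a| ^ (2 * s)) * (1 + |c| ^ (2 * s))
          + (1 + |b| ^ (2 * s)) * (1 + |c| ^ (2 * s))) hDD)
  have hPk : |c - b| ≤ P := by
    rw [← hk', hP]; exact le_mul_of_one_le_right (abs_nonneg _) hl
  have hPl : |c - a| ≤ P := by
    rw [← hl', hP]; exact le_mul_of_one_le_left (abs_nonneg _) hk
  have d1 := abs_sub_abs_le_abs_sub c b
  have d2 := abs_sub_abs_le_abs_sub b c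
  have d3 := abs_sub_abs_le_abs_sub a c
  rw [abs_sub_comm b c] at d2
  rw [abs_sub_comm a c] at d3
  rcases le_or_gt (J / 10) |a| with ha | ha <;> rcases le_or_gt (J / 10) |b| with hb | hb
  · exact fin_ab (two_big a b ha hb)
  · rcases le_or_gt (J / 10) |c| with hc | hc
    · exact fin_ac (two_big a c ha hc)
    · exact fin_ab (one_big a b ha (by linarith))
  · rcases le_or_gt (J / 10) |c| with hc | hc
    · exact fin_bc (two_big b c hb hc)
    · exact fin_bc (one_big b c hb (by linarith))
  · have hc : J / 10 ≤ |c| := by linarith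
    have := one_big c a hc (by linarith)
    rw [mul_comm (1 + |c| ^ (2 * s))] at this
    exact fin_ac this

theorem abs_res_ge {α : ℝ} (hα₁ : 3 / 4 < α) (hα₂ : α ≤ 1) (n p q : ℤ) :
    1 / 2 * (|(p : ℝ)| + |(q : ℝ)| + |((p + q - n : ℤ) : ℝ)|) ^ (2 * α - 2) *
      (|((p - n : ℤ) : ℝ)| * |((q - n : ℤ) : ℝ)|) ≤ |res α p q (p + q - n)| := by
  push_cast
  set J : ℝ := |(p : ℝ)| + |(q : ℝ)| + |(p : ℝ) + q - n| with hJ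
  have e1 : (n : ℝ) + (p - n) = p := by ring
  have e2 : (n : ℝ) + (q - n) = q := by ring
  have e3 : (n : ℝ) + (p - n) + (q - n) = p + q - n := by ring
  have hn : |(n : ℝ)| ≤ J := by
    calc |(n : ℝ)| = |(p : ℝ) + q - (p + q - n)| := by congr 1; ring
      _ ≤ _ := (abs_sub _ _).trans (by linarith [abs_add_le (p : ℝ) q])
  have hp := abs_nonneg (p : ℝ)
  have hq := abs_nonneg (q : ℝ)
  have hr := abs_nonneg ((p : ℝ) + q - n)
  have h := abs_second_diff_abs_rpow_ge (γ := 2 * α) (J := J) (x := n) (k := p - n) (l := q - n)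
    (by linarith) (by linarith) hn (by rw [e1]; linarith) (by rw [e2]; linarith)
    (by rw [e3]; linarith)
  rw [e3, e1, e2] at h
  have hres : res α p q (p + q - n) = |(p : ℝ)| ^ (2 * α) + |(q : ℝ)| ^ (2 * α)
      - |(p : ℝ) + q - n| ^ (2 * α) - |(n : ℝ)| ^ (2 * α) := by
    unfold res
    push_cast
    rw [show (p : ℝ) + q - (p + q - n) = n by ring]
  rw [hres]
  refine le_trans ?_ h
  have : 1 / 2 ≤ 2 * α * (2 * α - 1) := by nlinarith
  gcongr

theorem sub_ne_zero_of_res_ne_zero {α : ℝ} {n p q : ℤ} (h : res α p q (p + q - n) ≠ 0) :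
    p - n ≠ 0 ∧ q - n ≠ 0 := by
  constructor
  · intro h0
    obtain rfl : p = n := by omega
    apply h
    simp [res]
  · intro h0
    obtain rfl : q = n := by omega
    apply h
    simp [res]

theorem weight_div_res_sq_le {α s : ℝ} (hα₁ : 3 / 4 < α) (hα₂ : α ≤ 1) (hs : 2 - 2 * α ≤ s)
    {n p q : ℤ} (h : res α p q (p + q - n) ≠ 0) :
    (1 + |(n : ℝ)| ^ (2 * s)) * (1 / |res α p q (p + q - n)|) ^ 2 ≤
      |((p - n : ℤ) : ℝ)| ^ (-(4 * α - 2)) * |((q - n : ℤ) : ℝ)| ^ (-(4 * α - 2)) *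
      (32 * ((10 : ℝ) ^ (2 * s)) ^ 2 *
        ((1 + |(p : ℝ)| ^ (2 * s)) * (1 + |(q : ℝ)| ^ (2 * s))
          + (1 + |(p : ℝ)| ^ (2 * s)) * (1 + |((p + q - n : ℤ) : ℝ)| ^ (2 * s))
          + (1 + |(q : ℝ)| ^ (2 * s)) * (1 + |((p + q - n : ℤ) : ℝ)| ^ (2 * s)))) := by
  obtain ⟨hk, hl⟩ := sub_ne_zero_of_res_ne_zero h
  have hk1 : (1 : ℝ) ≤ |((p - n : ℤ) : ℝ)| := by exact_mod_cast Int.one_le_abs hk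
  have hl1 : (1 : ℝ) ≤ |((q - n : ℤ) : ℝ)| := by exact_mod_cast Int.one_le_abs hl
  have hres := abs_res_ge hα₁ hα₂ n p q
  have hcore := one_add_abs_rpow_mul_ratio_le (s := s) (δ := 2 - 2 * α) (a := p) (b := q)
    (c := ((p + q - n : ℤ) : ℝ)) (n := n) (by linarith) (by linarith) hs (by push_cast; ring)
    (by exact_mod_cast hk1) (by exact_mod_cast hl1)
  rw [← Int.cast_sub, ← Int.cast_sub] at hcore
  have hJ : 0 < |(p : ℝ)| + |(q : ℝ)| + |((p + q - n : ℤ) : ℝ)| := by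
    have h1 : ((p - n : ℤ) : ℝ) = ((p + q - n : ℤ) : ℝ) - q := by push_cast; ring
    have h2 := abs_sub ((p + q - n : ℤ) : ℝ) q
    rw [← h1] at h2
    have := abs_nonneg (p : ℝ)
    linarith
  set J := |(p : ℝ)| + |(q : ℝ)| + |((p + q - n : ℤ) : ℝ)|
  set k := |((p - n : ℤ) : ℝ)|
  set l := |((q - n : ℤ) : ℝ)|
  set M := (1 + |(p : ℝ)| ^ (2 * s)) * (1 + |(q : ℝ)| ^ (2 * s))
          + (1 + |(p : ℝ)| ^ (2 * s)) * (1 + |((p + q - n : ℤ) : ℝ)| ^ (2 * s))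
          + (1 + |(q : ℝ)| ^ (2 * s)) * (1 + |((p + q - n : ℤ) : ℝ)| ^ (2 * s))
  have hP : 0 < k * l := by positivity
  have hinv : (1 / |res α p q (p + q - n)|) ^ 2 ≤
      4 * ((k * l) ^ (-(4 * α - 2)) * (J / (k * l)) ^ (2 * (2 - 2 * α))) := by
    have h1 : 1 / |res α p q (p + q - n)| ≤ 1 / (1 / 2 * J ^ (2 * α - 2) * (k * l)) :=
      one_div_le_one_div_of_le (by positivity) hres
    refine (pow_le_pow_left₀ (by positivity) h1 2).trans_eq ?_
    have e1 : (J ^ (2 * α - 2)) ^ 2 = (J ^ (2 * (2 - 2 * α)))⁻¹ := by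
      rw [← Real.rpow_neg hJ.le, ← Real.rpow_mul_natCast hJ.le]
      congr 1; push_cast; ring
    have e2 : (k * l) ^ (-(4 * α - 2)) = (k * l) ^ (2 * (2 - 2 * α)) * ((k * l) ^ 2)⁻¹ := by
      rw [← Real.rpow_natCast, ← Real.rpow_neg hP.le, ← Real.rpow_add hP]
      congr 1; push_cast; ring
    rw [Real.div_rpow hJ.le hP.le, e2]
    have : (1 / (1 / 2 * J ^ (2 * α - 2) * (k * l))) ^ 2
        = 4 * (((J ^ (2 * α - 2)) ^ 2)⁻¹ * ((k * l) ^ 2)⁻¹) := by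
      field_simp; norm_num
    rw [this, e1, inv_inv]
    field_simp
  rw [← Real.mul_rpow (by positivity) (by positivity)]
  calc (1 + |(n : ℝ)| ^ (2 * s)) * (1 / |res α p q (p + q - n)|) ^ 2
      ≤ (1 + |(n : ℝ)| ^ (2 * s)) *
        (4 * ((k * l) ^ (-(4 * α - 2)) * (J / (k * l)) ^ (2 * (2 - 2 * α)))) := by gcongr
    _ = 4 * (k * l) ^ (-(4 * α - 2)) *
        ((1 + |(n : ℝ)| ^ (2 * s)) * (J / (k * l)) ^ (2 * (2 - 2 * α))) := by ring
    _ ≤ 4 * (k * l) ^ (-(4 * α - 2)) * (8 * ((10 : ℝ) ^ (2 * s)) ^ 2 * M) := by gcongr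
    _ = _ := by ring

theorem ENNReal.mul_tsum_sq_le {ι : Type*} {W : ℝ≥0∞} {f g h : ι → ℝ≥0∞}
    (H : ∀ i, W * f i ^ 2 ≤ g i * h i) :
    W * (∑' i, f i) ^ 2 ≤ (∑' i, g i) * ∑' i, h i := by
  have hsq : ∀ x : ℝ≥0∞, (x ^ (1 / 2 : ℝ)) ^ 2 = x := fun x => by
    rw [← ENNReal.rpow_natCast, ← ENNReal.rpow_mul]; norm_num
  have hsq' : ∀ x : ℝ≥0∞, (x ^ (1 / 2 : ℝ)) ^ (2 : ℝ) = x := fun x => by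
    rw [← ENNReal.rpow_mul]; norm_num
  have hpt : ∀ i, W ^ (1 / 2 : ℝ) * f i ≤ g i ^ (1 / 2 : ℝ) * h i ^ (1 / 2 : ℝ) := fun i => by
    have := ENNReal.rpow_le_rpow (H i) (by norm_num : (0 : ℝ) ≤ 1 / 2)
    rwa [ENNReal.mul_rpow_of_nonneg _ _ (by norm_num), ENNReal.mul_rpow_of_nonneg _ _ (by norm_num),
      ← ENNReal.rpow_natCast (f i), ← ENNReal.rpow_mul, show ((2 : ℕ) : ℝ) * (1 / 2) = 1 by norm_num,
      ENNReal.rpow_one] at this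
  let : MeasurableSpace ι := ⊤
  have hCS := ENNReal.lintegral_mul_le_Lp_mul_Lq (Measure.count : Measure ι)
    Real.HolderConjugate.two_two (f := fun i => g i ^ (1 / 2 : ℝ)) (g := fun i => h i ^ (1 / 2 : ℝ))
    measurable_from_top.aemeasurable measurable_from_top.aemeasurable
  simp only [Pi.mul_apply, lintegral_count' measurable_from_top, hsq'] at hCS
  calc W * (∑' i, f i) ^ 2 = (∑' i, W ^ (1 / 2 : ℝ) * f i) ^ 2 := by
        rw [ENNReal.tsum_mul_left, mul_pow, hsq]
    _ ≤ ((∑' i, g i) ^ (1 / 2 : ℝ) * (∑' i, h i) ^ (1 / 2 : ℝ)) ^ 2 :=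
        pow_le_pow_left₀ zero_le ((ENNReal.tsum_le_tsum hpt).trans hCS) 2
    _ = _ := by rw [mul_pow, hsq, hsq]

theorem ENNReal.add_add_sq_le (x y z : ℝ≥0∞) :
    (x + y + z) ^ 2 ≤ 3 * (x ^ 2 + y ^ 2 + z ^ 2) := by
  have := ENNReal.mul_tsum_sq_le (W := 1) (f := ![x, y, z]) (g := fun _ => 1)
    (h := fun i => ![x, y, z] i ^ 2) (fun i => le_rfl)
  simpa [tsum_fintype, Fin.sum_univ_three] using this

/-- The squared `H^s` norm of a nonnegative sequence. -/
def sobolevSq (s : ℝ) (a : ℤ → ℝ≥0∞) : ℝ≥0∞ :=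
  ∑' n : ℤ, ENNReal.ofReal (1 + |(n : ℝ)| ^ (2 * s)) * a n ^ 2

/-- The modulus of the Birkhoff trilinear form applied to nonnegative sequences. -/
def triE (α : ℝ) (a b c : ℤ → ℝ≥0∞) (n : ℤ) : ℝ≥0∞ :=
  ∑' p : ℤ × ℤ, ENNReal.ofReal (1 / |res α p.1 p.2 (p.1 + p.2 - n)|) *
    (a p.1 * b p.2 * c (p.1 + p.2 - n))

theorem one_le_weight (s : ℝ) (n : ℤ) : 1 ≤ ENNReal.ofReal (1 + |(n : ℝ)| ^ (2 * s)) := by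
  rw [ENNReal.one_le_ofReal]
  have : 0 ≤ |(n : ℝ)| ^ (2 * s) := Real.rpow_nonneg (abs_nonneg _) _
  linarith

theorem tsum_sq_le_sobolevSq (s : ℝ) (a : ℤ → ℝ≥0∞) : ∑' n, a n ^ 2 ≤ sobolevSq s a :=
  ENNReal.tsum_le_tsum fun n => le_mul_of_one_le_left zero_le (one_le_weight s n)

theorem tsum_tsum_tsum_mul (f g h : ℤ → ℝ≥0∞) :
    ∑' n : ℤ, ∑' p : ℤ × ℤ, f p.1 * g p.2 * h (p.1 + p.2 - n) =
      (∑' n, f n) * (∑' n, g n) * ∑' n, h n := by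
  rw [ENNReal.tsum_comm]
  have : ∀ p : ℤ × ℤ, ∑' n : ℤ, f p.1 * g p.2 * h (p.1 + p.2 - n) =
      f p.1 * g p.2 * ∑' n, h n := fun p => by
    rw [ENNReal.tsum_mul_left, ← (Equiv.subLeft (p.1 + p.2)).tsum_eq h]
    rfl
  simp_rw [this]
  rw [ENNReal.tsum_mul_right, ENNReal.tsum_prod (f := fun a b => f a * g b)]
  simp_rw [ENNReal.tsum_mul_left]
  rw [ENNReal.tsum_mul_right]

theorem exists_sobolevSq_triE_le {α s : ℝ} (hα₁ : 3 / 4 < α) (hα₂ : α ≤ 1)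
    (hs : 2 - 2 * α ≤ s) :
    ∃ C : ℝ≥0∞, C ≠ ⊤ ∧ ∀ a b c : ℤ → ℝ≥0∞, sobolevSq s (triE α a b c) ≤
      C * (sobolevSq s a * sobolevSq s b * (∑' n, c n ^ 2)
        + sobolevSq s a * (∑' n, b n ^ 2) * sobolevSq s c
        + (∑' n, a n ^ 2) * sobolevSq s b * sobolevSq s c) := by
  set w : ℤ → ℝ≥0∞ := fun n => ENNReal.ofReal (1 + |(n : ℝ)| ^ (2 * s)) with hw
  set θ : ℤ → ℝ≥0∞ := fun n => ENNReal.ofReal (|(n : ℝ)| ^ (-(4 * α - 2))) with hθ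
  set K : ℝ≥0∞ := ENNReal.ofReal (32 * ((10 : ℝ) ^ (2 * s)) ^ 2) with hK
  have hθ_top : ∑' n, θ n ≠ ⊤ :=
    (Real.summable_abs_int_rpow (by linarith : 1 < 4 * α - 2)).tsum_ofReal_ne_top
  refine ⟨(∑' n, θ n) * (∑' n, θ n) * K, by finiteness, fun a b c => ?_⟩
  have hker : ∀ n p q : ℤ,
      w n * ENNReal.ofReal (1 / |res α p q (p + q - n)|) ^ 2 ≤
        θ (p - n) * θ (q - n) *
          (K * (w p * w q + w p * w (p + q - n) + w q * w (p + q - n))) := by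
    intro n p q
    by_cases h : res α p q (p + q - n) = 0
    · simp [h]
    obtain ⟨W, hW⟩ : ∃ W : ℤ → ℝ, W = fun m : ℤ => 1 + |(m : ℝ)| ^ (2 * s) := ⟨_, rfl⟩
    have hW0 : ∀ m, 0 ≤ W m := fun m => by rw [hW]; positivity
    have hWm : ∀ m : ℤ, 1 + |(m : ℝ)| ^ (2 * s) = W m := fun m => by rw [hW]
    have hbound := weight_div_res_sq_le hα₁ hα₂ hs h
    simp only [hw, hWm] at hbound ⊢
    have hp := hW0 p
    have hq := hW0 q
    have hr := hW0 (p + q - n)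
    have := ENNReal.ofReal_le_ofReal hbound
    rwa [ENNReal.ofReal_mul (hW0 n), ENNReal.ofReal_pow (by positivity),
      ENNReal.ofReal_mul (by positivity), ENNReal.ofReal_mul (by positivity),
      ENNReal.ofReal_mul (by positivity), ENNReal.ofReal_add (by positivity) (by positivity),
      ENNReal.ofReal_add (by positivity) (by positivity), ENNReal.ofReal_mul hp,
      ENNReal.ofReal_mul hp, ENNReal.ofReal_mul hq] at this
  have hpt : ∀ n : ℤ, w n * triE α a b c n ^ 2 ≤ (∑' n, θ n) * (∑' n, θ n) *
      ∑' p : ℤ × ℤ, K * (w p.1 * w p.2 + w p.1 * w (p.1 + p.2 - n) + w p.2 * w (p.1 + p.2 - n)) *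
        (a p.1 * b p.2 * c (p.1 + p.2 - n)) ^ 2 := by
    intro n
    have hθθ : ∑' p : ℤ × ℤ, θ (p.1 - n) * θ (p.2 - n) = (∑' n, θ n) * ∑' n, θ n := by
      rw [ENNReal.tsum_prod (f := fun x y => θ (x - n) * θ (y - n))]
      simp_rw [ENNReal.tsum_mul_left]
      have hshift : ∑' x, θ (x - n) = ∑' x, θ x := (Equiv.subRight n).tsum_eq θ
      rw [ENNReal.tsum_mul_right, hshift]
    rw [← hθθ]
    refine ENNReal.mul_tsum_sq_le fun p => ?_
    rw [mul_pow, ← mul_assoc, ← mul_assoc]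
    exact mul_le_mul_left (hker n p.1 p.2) _
  calc sobolevSq s (triE α a b c)
      ≤ ∑' n, (∑' n, θ n) * (∑' n, θ n) *
        ∑' p : ℤ × ℤ, K * (w p.1 * w p.2 + w p.1 * w (p.1 + p.2 - n)
          + w p.2 * w (p.1 + p.2 - n)) * (a p.1 * b p.2 * c (p.1 + p.2 - n)) ^ 2 :=
        ENNReal.tsum_le_tsum hpt
    _ = (∑' n, θ n) * (∑' n, θ n) * K * ∑' n, ∑' p : ℤ × ℤ,
          ((w p.1 * a p.1 ^ 2) * (w p.2 * b p.2 ^ 2) * c (p.1 + p.2 - n) ^ 2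
          + (w p.1 * a p.1 ^ 2) * b p.2 ^ 2 * (w (p.1 + p.2 - n) * c (p.1 + p.2 - n) ^ 2)
          + a p.1 ^ 2 * (w p.2 * b p.2 ^ 2) * (w (p.1 + p.2 - n) * c (p.1 + p.2 - n) ^ 2)) := by
        rw [ENNReal.tsum_mul_left, mul_assoc _ K, ← ENNReal.tsum_mul_left (a := K)]
        congr 2
        funext n
        rw [← ENNReal.tsum_mul_left]
        congr 1
        funext p
        ring
    _ = _ := by
        simp_rw [ENNReal.tsum_add]
        rw [tsum_tsum_tsum_mul (fun n => w n * a n ^ 2) (fun n => w n * b n ^ 2)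
            (fun n => c n ^ 2),
          tsum_tsum_tsum_mul (fun n => w n * a n ^ 2) (fun n => b n ^ 2)
            (fun n => w n * c n ^ 2),
          tsum_tsum_tsum_mul (fun n => a n ^ 2) (fun n => w n * b n ^ 2)
            (fun n => w n * c n ^ 2)]
        rfl

/-- The summand in the definition of the Birkhoff vector field. -/
def birkhoffTerm (α σ : ℝ) (N : ℕ∞) (u : ℤ → ℂ) (n : ℤ) (p : ℤ × ℤ) : ℂ :=
  if inBall N p.1 ∧ inBall N p.2 ∧ inBall N (p.1 + p.2 - n) ∧
      res α p.1 p.2 (p.1 + p.2 - n) ≠ 0 then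
    ((-σ / res α p.1 p.2 (p.1 + p.2 - n) : ℝ) : ℂ) *
      (u p.1 * u p.2 * conj (u (p.1 + p.2 - n)))
  else 0

theorem enorm_birkhoffTerm_sub_le {α σ : ℝ} (hσ : |σ| = 1) (N : ℕ∞) (u v : ℤ → ℂ) (n : ℤ)
    (p : ℤ × ℤ) :
    ‖birkhoffTerm α σ N u n p - birkhoffTerm α σ N v n p‖ₑ ≤
      ENNReal.ofReal (1 / |res α p.1 p.2 (p.1 + p.2 - n)|) *
        ‖u p.1 * u p.2 * conj (u (p.1 + p.2 - n)) - v p.1 * v p.2 * conj (v (p.1 + p.2 - n))‖ₑ := by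
  unfold birkhoffTerm
  split_ifs
  · rw [← mul_sub, enorm_mul]
    gcongr
    rw [← ofReal_norm, Complex.norm_real, Real.norm_eq_abs, abs_div, abs_neg, hσ]
  · simp

theorem enorm_XB_sub_le {α σ : ℝ} (hσ : |σ| = 1) (N : ℕ∞) {u v : ℤ → ℂ} {n : ℤ}
    (hu : triE α (fun m => ‖u m‖ₑ) (fun m => ‖u m‖ₑ) (fun m => ‖u m‖ₑ) n ≠ ⊤)
    (hv : triE α (fun m => ‖v m‖ₑ) (fun m => ‖v m‖ₑ) (fun m => ‖v m‖ₑ) n ≠ ⊤) :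
    ‖XB α σ N u n - XB α σ N v n‖ₑ ≤
      triE α (fun m => ‖u m - v m‖ₑ) (fun m => ‖u m‖ₑ) (fun m => ‖u m‖ₑ) n
      + triE α (fun m => ‖v m‖ₑ) (fun m => ‖u m - v m‖ₑ) (fun m => ‖u m‖ₑ) n
      + triE α (fun m => ‖v m‖ₑ) (fun m => ‖v m‖ₑ) (fun m => ‖u m - v m‖ₑ) n := by
  have hsum : ∀ x : ℤ → ℂ,
      triE α (fun m => ‖x m‖ₑ) (fun m => ‖x m‖ₑ) (fun m => ‖x m‖ₑ) n ≠ ⊤ →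
      Summable (birkhoffTerm α σ N x n) := by
    intro x hx
    refine Summable.of_enorm (ne_top_of_le_ne_top hx (ENNReal.tsum_le_tsum fun p => ?_))
    simpa [birkhoffTerm, enorm_mul] using enorm_birkhoffTerm_sub_le hσ N x 0 n p
  have hX : ∀ x : ℤ → ℂ, XB α σ N x n =
      if inBall N n then ∑' p, birkhoffTerm α σ N x n p else 0 := fun x => rfl
  rw [hX, hX]
  split_ifs
  · rw [← (hsum u hu).tsum_sub (hsum v hv)]
    refine enorm_tsum_le_tsum_enorm.trans ?_
    unfold triE
    rw [← ENNReal.tsum_add, ← ENNReal.tsum_add]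
    refine ENNReal.tsum_le_tsum fun p => (enorm_birkhoffTerm_sub_le hσ N u v n p).trans ?_
    rw [← mul_add, ← mul_add]
    gcongr
    have : u p.1 * u p.2 * conj (u (p.1 + p.2 - n)) - v p.1 * v p.2 * conj (v (p.1 + p.2 - n))
        = (u p.1 - v p.1) * u p.2 * conj (u (p.1 + p.2 - n))
          + v p.1 * (u p.2 - v p.2) * conj (u (p.1 + p.2 - n))
          + v p.1 * v p.2 * conj (u (p.1 + p.2 - n) - v (p.1 + p.2 - n)) := by
      rw [map_sub]; ring
    rw [this]
    refine (enorm_add_le _ _).trans (add_le_add ((enorm_add_le _ _).trans ?_) ?_)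
    · simp [enorm_mul]
    · simp only [enorm_mul, RCLike.enorm_conj]; rfl
  · simp

theorem hsE_eq (s : ℝ) (u : ℤ → ℂ) :
    hsE s u = sobolevSq s (fun n => ‖u n‖ₑ) ^ (1 / 2 : ℝ) := rfl

theorem hsE_sq (s : ℝ) (u : ℤ → ℂ) : hsE s u ^ 2 = sobolevSq s (fun n => ‖u n‖ₑ) := by
  rw [hsE_eq, ← ENNReal.rpow_natCast, ← ENNReal.rpow_mul]; norm_num

theorem ENNReal.le_of_sq_le_sq {a b : ℝ≥0∞} (h : a ^ 2 ≤ b ^ 2) : a ≤ b :=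
  (ENNReal.pow_le_pow_left_iff two_ne_zero).1 h

theorem XB_zero (α σ : ℝ) (N : ℕ∞) (n : ℤ) : XB α σ N (fun _ => 0) n = 0 := by
  simp [XB]

/-- Estimates for the fractional Birkhoff vector field `X_N`, `3/4 < α ≤ 1`, `s ≥ 2 - 2α`. -/
theorem statement_9 (α : ℝ) (hα₁ : 3/4 < α) (hα₂ : α ≤ 1) (s : ℝ) (hs : 2 - 2*α ≤ s) :
    ∃ C : ℝ, 0 < C ∧ ∀ σ : ℝ, (σ = 1 ∨ σ = -1) → ∀ N : ℕ∞, ∀ u v : ℤ → ℂ,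
      hsE s u ≠ ⊤ → hsE s v ≠ ⊤ →
      hsE s (XB α σ N u) ≤ ENNReal.ofReal C * hsE s u ^ 2 * hsE 0 u ∧
      hsE s (fun n => XB α σ N u n - XB α σ N v n)
        ≤ ENNReal.ofReal C * hsE s (fun n => u n - v n) * (hsE s u ^ 2 + hsE s v ^ 2) := by
  obtain ⟨K, hK, hT⟩ := exists_sobolevSq_triE_le hα₁ hα₂ hs
  have hconst : 9 * K ≤ ENNReal.ofReal ((9 * K).toReal + 1) ^ 2 := by
    have h1 : 9 * K ≤ ENNReal.ofReal ((9 * K).toReal + 1) := by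
      rw [ENNReal.le_ofReal_iff_toReal_le (by finiteness) (by positivity)]
      linarith
    have h2 : 1 ≤ ENNReal.ofReal ((9 * K).toReal + 1) := by
      rw [ENNReal.one_le_ofReal]
      linarith [ENNReal.toReal_nonneg (a := 9 * K)]
    rw [sq]
    exact h1.trans (le_mul_of_one_le_left zero_le h2)
  have hsq_top : ∀ u : ℤ → ℂ, hsE s u ≠ ⊤ → sobolevSq s (fun n => ‖u n‖ₑ) ≠ ⊤ := fun u hu => by
    rw [← hsE_sq]; finiteness
  have hfin : ∀ u : ℤ → ℂ, hsE s u ≠ ⊤ → ∀ n,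
      triE α (fun m => ‖u m‖ₑ) (fun m => ‖u m‖ₑ) (fun m => ‖u m‖ₑ) n ≠ ⊤ := by
    intro u hu n
    have hE := hsq_top u hu
    have hL := ne_top_of_le_ne_top hE (tsum_sq_le_sobolevSq s fun n => ‖u n‖ₑ)
    have h1 : sobolevSq s (triE α (fun m => ‖u m‖ₑ) (fun m => ‖u m‖ₑ) (fun m => ‖u m‖ₑ)) ≠ ⊤ :=
      ne_top_of_le_ne_top (by finiteness) (hT _ _ _)
    have h2 := ne_top_of_le_ne_top h1
      ((ENNReal.le_tsum n).trans (tsum_sq_le_sobolevSq s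
        (triE α (fun m => ‖u m‖ₑ) (fun m => ‖u m‖ₑ) (fun m => ‖u m‖ₑ))))
    exact fun h => h2 (by simp [h])
  refine ⟨(9 * K).toReal + 1, by positivity, fun σ hσ N u v hu hv => ?_⟩
  have hσ1 : |σ| = 1 := by rcases hσ with rfl | rfl <;> simp
  constructor
  · apply ENNReal.le_of_sq_le_sq
    rw [mul_pow, mul_pow, hsE_sq, hsE_sq, hsE_sq]
    have hz : ∀ n, triE α (fun _ => ‖(0 : ℂ)‖ₑ) (fun _ => ‖(0 : ℂ)‖ₑ) (fun _ => ‖(0 : ℂ)‖ₑ) n ≠ ⊤ :=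
      fun n => by simp [triE]
    have hpt : ∀ n, ‖XB α σ N u n‖ₑ ≤
        triE α (fun m => ‖u m‖ₑ) (fun m => ‖u m‖ₑ) (fun m => ‖u m‖ₑ) n := fun n => by
      have := enorm_XB_sub_le hσ1 N (hfin u hu n) (hz n)
      rw [XB_zero] at this
      simpa [triE] using this
    calc sobolevSq s (fun n => ‖XB α σ N u n‖ₑ)
        ≤ sobolevSq s (triE α (fun m => ‖u m‖ₑ) (fun m => ‖u m‖ₑ) (fun m => ‖u m‖ₑ)) :=
          ENNReal.tsum_le_tsum fun n => by gcongr; exact hpt n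
      _ ≤ _ := hT _ _ _
      _ = 3 * K * (sobolevSq s (fun n => ‖u n‖ₑ) ^ 2 * ∑' n, ‖u n‖ₑ ^ 2) := by ring
      _ ≤ ENNReal.ofReal ((9 * K).toReal + 1) ^ 2 *
          (sobolevSq s (fun n => ‖u n‖ₑ) ^ 2 * sobolevSq 0 (fun n => ‖u n‖ₑ)) := by
          refine mul_le_mul' (le_trans ?_ hconst) (mul_le_mul' le_rfl (tsum_sq_le_sobolevSq 0 _))
          gcongr
          norm_num
      _ = _ := by ring
  · apply ENNReal.le_of_sq_le_sq
    rw [mul_pow, mul_pow, hsE_sq, hsE_sq, hsE_sq, hsE_sq]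
    have hT3 : ∀ a b c : ℤ → ℝ≥0∞, sobolevSq s (triE α a b c) ≤
        3 * K * (sobolevSq s a * sobolevSq s b * sobolevSq s c) := fun a b c => by
      refine (hT a b c).trans ?_
      have ha := tsum_sq_le_sobolevSq s a
      have hb := tsum_sq_le_sobolevSq s b
      have hc := tsum_sq_le_sobolevSq s c
      calc _ ≤ K * (sobolevSq s a * sobolevSq s b * sobolevSq s c
            + sobolevSq s a * sobolevSq s b * sobolevSq s c
            + sobolevSq s a * sobolevSq s b * sobolevSq s c) := by gcongr
        _ = _ := by ring
    set U := fun n => ‖u n‖ₑ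
    set V := fun n => ‖v n‖ₑ
    set D := fun n => ‖u n - v n‖ₑ
    calc sobolevSq s (fun n => ‖XB α σ N u n - XB α σ N v n‖ₑ)
        ≤ sobolevSq s (fun n => triE α D U U n + triE α V D U n + triE α V V D n) :=
          ENNReal.tsum_le_tsum fun n => by
            gcongr
            exact enorm_XB_sub_le hσ1 N (hfin u hu n) (hfin v hv n)
      _ ≤ 3 * (sobolevSq s (triE α D U U) + sobolevSq s (triE α V D U)
            + sobolevSq s (triE α V V D)) := by
          unfold sobolevSq
          rw [← ENNReal.tsum_add, ← ENNReal.tsum_add, ← ENNReal.tsum_mul_left]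
          refine ENNReal.tsum_le_tsum fun n => ?_
          rw [← mul_add, ← mul_add, mul_left_comm]
          gcongr
          exact ENNReal.add_add_sq_le _ _ _
      _ ≤ 3 * (3 * K * (sobolevSq s D * sobolevSq s U * sobolevSq s U)
            + 3 * K * (sobolevSq s V * sobolevSq s D * sobolevSq s U)
            + 3 * K * (sobolevSq s V * sobolevSq s V * sobolevSq s D)) := by
          gcongr <;> exact hT3 _ _ _
      _ ≤ 3 * (3 * K * (sobolevSq s D * sobolevSq s U * sobolevSq s U)
            + 3 * K * (sobolevSq s V * sobolevSq s D * sobolevSq s U)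
            + 3 * K * (sobolevSq s V * sobolevSq s V * sobolevSq s D))
            + 9 * K * (sobolevSq s V * sobolevSq s D * sobolevSq s U) := le_self_add
      _ = 9 * K * sobolevSq s D * (sobolevSq s U + sobolevSq s V) ^ 2 := by ring
      _ ≤ _ := by gcongr

end
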